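/- arXiv:0801.3615 — 5 statements merged into one kernel-verified Lean document; each statement's English description precedes it below -/
import Mathlib

section
/- Let n ≥ 1, h > 0, γ > 0, and let V : ℝⁿ → ℝ and u : ℝ^{2n} → ℝ be smooth. On ℝ^{2n} with coordinates (x,y), set φ(x,y) = V(x) + |y|²/2, and let A be the 2n×2n matrix with n×n blocks A = (1/2)·[[0, I], [−I, γI]], with symmetric part B = (1/2)·[[0,0],[0,γI]] and antisymmetric part C = (1/2)·[[0,I],[−I,0]]. Then the Witten–Hodge expression Σ_{j,k} hD_j( B_{jk} hD_k u ) + (Σ_{j,k} (∂_jφ) B_{jk} (∂_kφ)) u − h·tr( B·Hess φ ) u + Σ_{j,k} [ (∂_kφ) C_{jk} h∂_j u + h∂_j( C_{jk} (∂_kφ) u ) ] (indices running over all 2n coordinates, D_j = −i∂_j) equals Σ_j y_j h∂_{x_j} u − Σ_j (∂_{x_j}V) h∂_{y_j} u + (γ/2) Σ_j ( −h∂_{y_j} + y_j )[ ( h∂_{y_j} + y_j ) u ]. -/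
open scoped BigOperators

/-- Partial derivative `∂_j f` of a real-valued function on `ℝ^ι`. -/
noncomputable def pd {ι : Type*} [Fintype ι] [DecidableEq ι]
    (j : ι) (f : (ι → ℝ) → ℝ) (v : ι → ℝ) : ℝ :=
  fderiv ℝ f v (Pi.single j 1)

/-- Partial derivative `∂_j f` of a complex-valued function on `ℝ^ι`. -/
noncomputable def pdC {ι : Type*} [Fintype ι] [DecidableEq ι]
    (j : ι) (f : (ι → ℝ) → ℂ) (v : ι → ℝ) : ℂ :=
  fderiv ℝ f v (Pi.single j 1)

section PartialDerivatives

variable {ι : Type*} [Fintype ι] [DecidableEq ι]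

theorem contDiff_pd {f : (ι → ℝ) → ℝ} (hf : ContDiff ℝ (⊤ : ℕ∞) f) (j : ι) :
    ContDiff ℝ (⊤ : ℕ∞) (pd j f) :=
  (hf.fderiv_right (m := (⊤ : ℕ∞)) le_rfl).clm_apply contDiff_const

theorem pd_const_mul (j : ι) (c : ℝ) {f : (ι → ℝ) → ℝ} {p : ι → ℝ}
    (hf : DifferentiableAt ℝ f p) : pd j (fun w => c * f w) p = c * pd j f p := by
  simp [pd, fderiv_const_mul hf]

theorem pd_add (j : ι) {f g : (ι → ℝ) → ℝ} {p : ι → ℝ}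
    (hf : DifferentiableAt ℝ f p) (hg : DifferentiableAt ℝ g p) :
    pd j (fun w => f w + g w) p = pd j f p + pd j g p := by
  simp [pd, fderiv_fun_add hf hg]

theorem pd_mul (j : ι) {f g : (ι → ℝ) → ℝ} {p : ι → ℝ}
    (hf : DifferentiableAt ℝ f p) (hg : DifferentiableAt ℝ g p) :
    pd j (fun w => f w * g w) p = f p * pd j g p + g p * pd j f p := by
  simp [pd, fderiv_fun_mul hf hg]

theorem pd_coord (j k : ι) (p : ι → ℝ) :
    pd j (fun w => w k) p = if k = j then 1 else 0 := by
  simp [pd, (hasFDerivAt_apply (𝕜 := ℝ) k p).fderiv, Pi.single_apply]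

theorem pdC_ofReal (j : ι) {f : (ι → ℝ) → ℝ} {p : ι → ℝ} (hf : DifferentiableAt ℝ f p) :
    pdC j (fun w => ((f w : ℝ) : ℂ)) p = ((pd j f p : ℝ) : ℂ) := by
  have := (Complex.ofRealCLM.hasFDerivAt.comp p hf.hasFDerivAt).fderiv
  simp only [Function.comp_def, Complex.ofRealCLM_apply] at this
  simp [pdC, pd, this]

theorem pdC_const_mul (j : ι) (c : ℂ) {f : (ι → ℝ) → ℂ} {p : ι → ℝ}
    (hf : DifferentiableAt ℝ f p) : pdC j (fun w => c * f w) p = c * pdC j f p := by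
  simp [pdC, fderiv_const_mul hf]

theorem semiclassical_second_order {u : (ι → ℝ) → ℝ} (hu : ContDiff ℝ (⊤ : ℕ∞) u)
    (h b : ℝ) (j k : ι) (p : ι → ℝ) :
    (-Complex.I * (h : ℂ)) * pdC j (fun v => (b : ℂ) *
      ((-Complex.I * (h : ℂ)) * pdC k (fun w => ((u w : ℝ) : ℂ)) v)) p
    = ((b * -(h ^ 2 * pd j (pd k u) p) : ℝ) : ℂ) := by
  have hk : DifferentiableAt ℝ (pd k u) p := (contDiff_pd hu k).differentiable (by simp) p
  have hk' : DifferentiableAt ℝ (fun v => ((pd k u v : ℝ) : ℂ)) p :=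
    Complex.ofRealCLM.differentiableAt.comp p hk
  simp only [fun v => pdC_ofReal k (hu.differentiable (by simp) v)]
  rw [pdC_const_mul j _ (hk'.const_mul _), pdC_const_mul j _ hk', pdC_ofReal j hk]
  push_cast
  linear_combination (h ^ 2 * b * (pd j (pd k u) p : ℂ)) * Complex.I_sq

end PartialDerivatives

section KramersPotential

variable {n : ℕ} {V : (Fin n → ℝ) → ℝ}

theorem hasFDerivAt_comp_inl {p : Fin n ⊕ Fin n → ℝ}
    (hV : DifferentiableAt ℝ V (fun a => p (Sum.inl a))) :
    HasFDerivAt (fun v : Fin n ⊕ Fin n → ℝ => V (fun a => v (Sum.inl a)))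
      ((fderiv ℝ V (fun a => p (Sum.inl a))).comp
        (ContinuousLinearMap.pi fun a => ContinuousLinearMap.proj (Sum.inl a))) p :=
  HasFDerivAt.comp p hV.hasFDerivAt
    (ContinuousLinearMap.pi fun a : Fin n =>
      (ContinuousLinearMap.proj (Sum.inl a) : (Fin n ⊕ Fin n → ℝ) →L[ℝ] ℝ)).hasFDerivAt

theorem pd_inl_comp_inl (hV : Differentiable ℝ V) (i : Fin n) (p : Fin n ⊕ Fin n → ℝ) :
    pd (Sum.inl i) (fun v : Fin n ⊕ Fin n → ℝ => V (fun a => v (Sum.inl a))) p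
      = pd i V (fun a => p (Sum.inl a)) := by
  rw [pd, (hasFDerivAt_comp_inl (hV _)).fderiv, pd, ContinuousLinearMap.comp_apply]
  congr 1
  ext a
  simp [Pi.single_apply]

theorem pd_inr_comp_inl (hV : Differentiable ℝ V) (i : Fin n) (p : Fin n ⊕ Fin n → ℝ) :
    pd (Sum.inr i) (fun v : Fin n ⊕ Fin n → ℝ => V (fun a => v (Sum.inl a))) p = 0 := by
  rw [pd, (hasFDerivAt_comp_inl (hV _)).fderiv, ContinuousLinearMap.comp_apply]
  convert map_zero (fderiv ℝ V (fun a => p (Sum.inl a))) using 2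
  ext a
  simp

theorem pd_half_sum_sq (j : Fin n ⊕ Fin n) (p : Fin n ⊕ Fin n → ℝ) :
    pd j (fun v : Fin n ⊕ Fin n → ℝ => (∑ i, v (Sum.inr i) ^ 2) / 2) p
      = ∑ i, if Sum.inr i = j then p (Sum.inr i) else 0 := by
  have hsum : HasFDerivAt (fun v : Fin n ⊕ Fin n → ℝ => (∑ i, v (Sum.inr i) ^ 2) * 2⁻¹) _ p :=
    (HasFDerivAt.fun_sum fun i (_ : i ∈ Finset.univ) =>
      (hasFDerivAt_apply (𝕜 := ℝ) (Sum.inr i : Fin n ⊕ Fin n) p).pow 2).mul_const 2⁻¹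
  simp only [pd, div_eq_mul_inv, hsum.fderiv]
  simp [Finset.mul_sum, Pi.single_apply]

theorem pd_inl_kramers (hV : Differentiable ℝ V) (i : Fin n) :
    pd (Sum.inl i) (fun v : Fin n ⊕ Fin n → ℝ =>
        V (fun a => v (Sum.inl a)) + (∑ a, v (Sum.inr a) ^ 2) / 2)
      = fun p => pd i V (fun a => p (Sum.inl a)) := by
  funext p
  rw [pd_add _ (hasFDerivAt_comp_inl (hV _)).differentiableAt (by fun_prop),
    pd_inl_comp_inl hV, pd_half_sum_sq]
  simp

theorem pd_inr_kramers (hV : Differentiable ℝ V) (i : Fin n) :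
    pd (Sum.inr i) (fun v : Fin n ⊕ Fin n → ℝ =>
        V (fun a => v (Sum.inl a)) + (∑ a, v (Sum.inr a) ^ 2) / 2)
      = fun p => p (Sum.inr i) := by
  funext p
  rw [pd_add _ (hasFDerivAt_comp_inl (hV _)).differentiableAt (by fun_prop),
    pd_inr_comp_inl hV, pd_half_sum_sq]
  simp

end KramersPotential

/- STATEMENT 6: on ℝ^{2n} with φ(x,y) = V(x) + |y|²/2 and
A = (1/2)[[0,I],[−I,γI]] = B + C (B symmetric part, C antisymmetric part), the
Witten–Hodge expression
Σ hD_j(B_{jk} hD_k u) + (Σ ∂_jφ B_{jk} ∂_kφ) u − h tr(B Hess φ) u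
+ Σ [(∂_kφ)C_{jk} h∂_j u + h∂_j(C_{jk}(∂_kφ)u)]   (D_j = −i∂_j)
equals the Kramers–Fokker–Planck operator
Σ y_j h∂_{x_j}u − Σ (∂_{x_j}V) h∂_{y_j}u + (γ/2)Σ (−h∂_{y_j}+y_j)[(h∂_{y_j}+y_j)u]. -/
theorem stmt6 (n : ℕ) (hn : 1 ≤ n) (h γ : ℝ) (hh : 0 < h) (hγ : 0 < γ)
    (V : (Fin n → ℝ) → ℝ) (hV : ContDiff ℝ (⊤ : ℕ∞) V)
    (u : ((Fin n ⊕ Fin n) → ℝ) → ℝ) (hu : ContDiff ℝ (⊤ : ℕ∞) u)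
    (φ : ((Fin n ⊕ Fin n) → ℝ) → ℝ)
    (hφ : φ = fun v => V (fun i => v (Sum.inl i)) + (∑ i, v (Sum.inr i) ^ 2) / 2)
    (A B C : Matrix (Fin n ⊕ Fin n) (Fin n ⊕ Fin n) ℝ)
    (hA : A = B + C)
    (hB : B = Matrix.fromBlocks 0 0 0 ((γ / 2) • 1))
    (hC : C = Matrix.fromBlocks 0 ((1 / 2 : ℝ) • 1) ((-(1 / 2) : ℝ) • 1) 0) :
    ∀ p : (Fin n ⊕ Fin n) → ℝ,
      ((∑ j, ∑ k, (-Complex.I * (h : ℂ)) *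
            pdC j (fun v => (B j k : ℂ) *
              ((-Complex.I * (h : ℂ)) * pdC k (fun w => ((u w : ℝ) : ℂ)) v)) p)
        + (((∑ j, ∑ k, pd j φ p * B j k * pd k φ p : ℝ)) : ℂ) * ((u p : ℝ) : ℂ)
        - (h : ℂ) * (((∑ j, ∑ k, B j k * pd k (fun w => pd j φ w) p : ℝ)) : ℂ)
            * ((u p : ℝ) : ℂ)
        + (((∑ j, ∑ k, (pd k φ p * C j k * (h * pd j u p)
              + h * pd j (fun w => C j k * pd k φ w * u w) p) : ℝ)) : ℂ))
      = (((∑ i, p (Sum.inr i) * (h * pd (Sum.inl i) u p))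
          - (∑ i, pd i V (fun a => p (Sum.inl a)) * (h * pd (Sum.inr i) u p))
          + γ / 2 * ∑ i,
              (-(h * pd (Sum.inr i)
                    (fun w => h * pd (Sum.inr i) u w + w (Sum.inr i) * u w) p)
                + p (Sum.inr i) * (h * pd (Sum.inr i) u p + p (Sum.inr i) * u p))
          : ℝ) : ℂ) := by
  intro p
  have hVd : Differentiable ℝ V := hV.differentiable (by simp)
  have hud : Differentiable ℝ u := hu.differentiable (by simp)
  have hinl := pd_inl_kramers hVd
  have hinr := pd_inr_kramers hVd
  rw [← hφ] at hinl hinr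
  have hφs : ContDiff ℝ (⊤ : ℕ∞) φ := by
    rw [hφ]
    fun_prop
  have hφd (k : Fin n ⊕ Fin n) : Differentiable ℝ (pd k φ) :=
    (contDiff_pd hφs k).differentiable (by simp)
  have hdrift (j k : Fin n ⊕ Fin n) :
      pd k φ p * C j k * (h * pd j u p) + h * pd j (fun w => C j k * pd k φ w * u w) p
        = C j k * (h * (2 * pd k φ p * pd j u p + u p * pd j (pd k φ) p)) := by
    simp only [mul_assoc (C j k)]
    rw [pd_const_mul j _ ((hφd k p).fun_mul (hud p)), pd_mul j (hφd k p) (hud p)]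
    ring
  have hmixed (i : Fin n) : pd (Sum.inr i) (fun v : Fin n ⊕ Fin n → ℝ =>
      pd i V (fun a => v (Sum.inl a))) p = 0 :=
    pd_inr_comp_inl ((contDiff_pd hV i).differentiable (by simp)) i p
  have hcreate (i : Fin n) : pd (Sum.inr i)
      (fun w => h * pd (Sum.inr i) u w + w (Sum.inr i) * u w) p
        = h * pd (Sum.inr i) (pd (Sum.inr i) u) p
          + (p (Sum.inr i) * pd (Sum.inr i) u p + u p) := by
    have hdu : DifferentiableAt ℝ (pd (Sum.inr i) u) p :=
      (contDiff_pd hu _).differentiable (by simp) p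
    have hy : DifferentiableAt ℝ (fun w : Fin n ⊕ Fin n → ℝ => w (Sum.inr i)) p := by fun_prop
    rw [pd_add _ (hdu.const_mul h) (hy.fun_mul (hud p)), pd_const_mul _ _ hdu,
      pd_mul _ hy (hud p), pd_coord]
    simp
  simp only [semiclassical_second_order hu, hdrift, hcreate]
  norm_cast
  simp only [Fintype.sum_sum_type, hB, hC, hinl, hinr, Matrix.fromBlocks_apply₁₁,
    Matrix.fromBlocks_apply₁₂, Matrix.fromBlocks_apply₂₁, Matrix.fromBlocks_apply₂₂,
    Matrix.zero_apply, Matrix.smul_apply, Matrix.one_apply, smul_eq_mul, mul_ite, ite_mul,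
    mul_one, mul_zero, zero_mul, Finset.sum_const_zero, zero_add, add_zero, Finset.sum_ite_eq,
    Finset.mem_univ, if_true, hmixed, pd_coord, Sum.inr.injEq, reduceCtorEq, if_false]
  simp only [Finset.mul_sum, Finset.sum_mul, ← Finset.sum_add_distrib, ← Finset.sum_sub_distrib]
  refine Finset.sum_congr rfl fun i _ => ?_
  ring
end

section
/- Let d ≥ 1, C_V ≥ 1, and let V : ℝ^d → ℝ be C² with ‖Hess V(x)‖ ≤ C_V for all x ∈ ℝ^d. Fix z₀ ∈ ℝ^d and let (x(t), y(t)) be a solution on [0, 1/C_V] of the system ẋ = y, ẏ = −(∇V(x) − z₀) with x(0) = x₀, y(0) = y₀. If |y₀| ≥ |∇V(x₀) − z₀|, then for every t ∈ [0, 1/C_V] one has sup_{s ∈ [0,t]} |y(s) − y₀| ≤ 3 t |y₀|. -/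
theorem ContDiff.differentiable_gradient {E : Type*} [NormedAddCommGroup E]
    [InnerProductSpace ℝ E] [CompleteSpace E] {V : E → ℝ} (hV : ContDiff ℝ 2 V) :
    Differentiable ℝ (gradient V) := by
  have h : ContDiff ℝ 1 (fderiv ℝ V) := hV.fderiv_right (by norm_num)
  exact (InnerProductSpace.toDual ℝ E).symm.toContinuousLinearEquiv.differentiable.comp
    (h.differentiable (by norm_num))

/-- A bound for second order systems `ẋ = y`, `ẏ = -F x` with a Lipschitz force `F`, in terms of
an a priori bound `M` on the variation of `y`. -/
theorem norm_velocity_sub_le_of_lipschitz_force {E : Type*} [NormedAddCommGroup E]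
    [NormedSpace ℝ E] {F : E → E} {C M Y T : ℝ} {x y : ℝ → E} (hC : 0 ≤ C)
    (hF : ∀ a b, ‖F a - F b‖ ≤ C * ‖a - b‖)
    (hx : ∀ t ∈ Set.Icc 0 T, HasDerivAt x (y t) t)
    (hy : ∀ t ∈ Set.Icc 0 T, HasDerivAt y (-F (x t)) t)
    (hM : ∀ t ∈ Set.Icc 0 T, ‖y t - y 0‖ ≤ M) (hY : ‖y 0‖ ≤ Y) (hF0 : ‖F (x 0)‖ ≤ Y) :
    ∀ t ∈ Set.Icc 0 T, ‖y t - y 0‖ ≤ Y * t + C * (Y + M) * (t ^ 2 / 2) := by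
  have hvel : ∀ t ∈ Set.Icc 0 T, ‖y t‖ ≤ Y + M := fun t ht => by
    have := norm_add_le (y 0) (y t - y 0)
    rw [add_sub_cancel] at this
    linarith [hM t ht]
  have hpos : ∀ t ∈ Set.Icc 0 T, ‖x t - x 0‖ ≤ (Y + M) * t := fun t ht => by
    simpa using norm_image_sub_le_of_norm_deriv_le_segment'
      (fun s hs => (hx s hs).hasDerivWithinAt) (fun s hs => hvel s (Set.Ico_subset_Icc_self hs))
      t ht
  have hforce : ∀ t ∈ Set.Icc 0 T, ‖-F (x t)‖ ≤ Y + C * (Y + M) * t := fun t ht => by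
    have h1 := norm_add_le (F (x 0)) (F (x t) - F (x 0))
    rw [add_sub_cancel] at h1
    have h2 := mul_le_mul_of_nonneg_left (hpos t ht) hC
    rw [norm_neg]
    linarith [hF (x t) (x 0)]
  intro t ht
  refine image_norm_le_of_norm_deriv_right_le_deriv_boundary
    (f := fun s => y s - y 0) (f' := fun s => -F (x s))
    (B := fun s => Y * s + C * (Y + M) * (s ^ 2 / 2)) (B' := fun s => Y + C * (Y + M) * s)
    (fun s hs => ((hy s hs).sub_const _).continuousAt.continuousWithinAt)
    (fun s hs => ((hy s (Set.Ico_subset_Icc_self hs)).sub_const _).hasDerivWithinAt)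
    (by simp) (fun s => ?_) (fun s hs => hforce s (Set.Ico_subset_Icc_self hs)) ht
  have h := ((hasDerivAt_id s).const_mul Y).add
    ((((hasDerivAt_id s).pow 2).div_const 2).const_mul (C * (Y + M)))
  exact h.congr_deriv (by simp)

/- STATEMENT 13: for the characteristic flow ẋ = y, ẏ = −(∇V(x) − z₀) with
‖Hess V‖ ≤ C_V everywhere and |y₀| ≥ |∇V(x₀) − z₀|, one has
sup_{s∈[0,t]} |y(s) − y₀| ≤ 3t|y₀| for all t ∈ [0, 1/C_V]. -/
theorem stmt13 (d : ℕ) (hd : 1 ≤ d) (CV : ℝ) (hCV : 1 ≤ CV)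
    (V : EuclideanSpace ℝ (Fin d) → ℝ) (hV : ContDiff ℝ 2 V)
    (hHess : ∀ x, ‖fderiv ℝ (gradient V) x‖ ≤ CV)
    (z₀ x₀ y₀ : EuclideanSpace ℝ (Fin d))
    (x y : ℝ → EuclideanSpace ℝ (Fin d))
    (hx0 : x 0 = x₀) (hy0 : y 0 = y₀)
    (hx : ∀ t ∈ Set.Icc (0 : ℝ) (1 / CV), HasDerivAt x (y t) t)
    (hy : ∀ t ∈ Set.Icc (0 : ℝ) (1 / CV),
      HasDerivAt y (-(gradient V (x t) - z₀)) t)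
    (hinit : ‖gradient V x₀ - z₀‖ ≤ ‖y₀‖) :
    ∀ t ∈ Set.Icc (0 : ℝ) (1 / CV), ∀ s ∈ Set.Icc (0 : ℝ) t,
      ‖y s - y₀‖ ≤ 3 * t * ‖y₀‖ := by
  subst hx0 hy0
  have hCV0 : 0 < CV := by linarith
  have hF : ∀ a b, ‖(gradient V a - z₀) - (gradient V b - z₀)‖ ≤ CV * ‖a - b‖ := fun a b => by
    rw [sub_sub_sub_cancel_right]
    exact convex_univ.norm_image_sub_le_of_norm_fderiv_le
      (fun c _ => hV.differentiable_gradient c) (fun c _ => hHess c)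
      (Set.mem_univ b) (Set.mem_univ a)
  intro t ht s hs
  have hsub : Set.Icc 0 t ⊆ Set.Icc 0 (1 / CV) := Set.Icc_subset_Icc_right ht.2
  have hcont : ContinuousOn (fun r => ‖y r - y 0‖) (Set.Icc 0 t) := fun r hr =>
    ((hy r (hsub hr)).sub_const _).continuousAt.norm.continuousWithinAt
  obtain ⟨m, hm, hmax⟩ := isCompact_Icc.exists_isMaxOn ⟨s, hs⟩ hcont
  have hM : ∀ r ∈ Set.Icc 0 t, ‖y r - y 0‖ ≤ ‖y m - y 0‖ := fun r hr => hmax hr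
  have hbound := norm_velocity_sub_le_of_lipschitz_force hCV0.le hF
    (fun r hr => hx r (hsub hr)) (fun r hr => hy r (hsub hr)) hM le_rfl hinit m hm
  refine (hM s hs).trans ?_
  set M := ‖y m - y 0‖
  set Y := ‖y 0‖
  have hM0 : 0 ≤ M := norm_nonneg _
  have hY0 : 0 ≤ Y := norm_nonneg _
  have hCt : CV * t ≤ 1 := by
    have := (le_div_iff₀ hCV0).1 ht.2
    linarith
  have ht1 : t ≤ 1 := by nlinarith [ht.1]
  have hCm : CV * m ^ 2 ≤ t := by
    calc CV * m ^ 2 ≤ CV * t ^ 2 := by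
          have := hm.1
          have := hm.2
          gcongr
      _ = CV * t * t := by ring
      _ ≤ 1 * t := mul_le_mul_of_nonneg_right hCt ht.1
      _ = t := one_mul t
  have h1 : Y * m ≤ Y * t := mul_le_mul_of_nonneg_left hm.2 hY0
  have h2 : CV * m ^ 2 * (Y + M) ≤ t * (Y + M) :=
    mul_le_mul_of_nonneg_right hCm (add_nonneg hY0 hM0)
  have h3 : t * M ≤ M := mul_le_of_le_one_left hM0 ht1
  linarith
end

section
/- Let d ≥ 1, C_V ≥ 1, and let V : ℝ^d → ℝ be C² with ‖Hess V(x)‖ ≤ C_V for all x ∈ ℝ^d. Fix z₀ ∈ ℝ^d and let (x(t), y(t)) be a solution on [0, 1/C_V] of the system ẋ = y, ẏ = −(∇V(x) − z₀) with x(0) = x₀, y(0) = y₀. If |y₀| ≥ |∇V(x₀) − z₀|, then for every t ∈ [0, 1/C_V] one has |x(t) − x₀ − t y₀| ≤ (3/2) t² |y₀|. -/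
/-- A curve starting at `0` whose speed is at most `p + q * s` at time `s` has norm at most
`p * s + q / 2 * s ^ 2` at time `s`. -/
lemma norm_le_of_norm_deriv_le_affine {E : Type*} [NormedAddCommGroup E] [NormedSpace ℝ E]
    {f f' : ℝ → E} {p q T : ℝ} (h0 : f 0 = 0)
    (hf : ∀ s ∈ Set.Icc 0 T, HasDerivAt f (f' s) s)
    (hb : ∀ s ∈ Set.Icc 0 T, ‖f' s‖ ≤ p + q * s) :
    ∀ s ∈ Set.Icc 0 T, ‖f s‖ ≤ p * s + q / 2 * s ^ 2 := by
  have hB : ∀ s : ℝ, HasDerivAt (fun s : ℝ => p * s + q / 2 * s ^ 2) (p + q * s) s := by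
    intro s
    have h := ((hasDerivAt_id s).const_mul p).add ((hasDerivAt_pow 2 s).const_mul (q / 2))
    refine h.congr_deriv ?_
    push_cast
    ring
  intro s hs
  exact image_norm_le_of_norm_deriv_right_le_deriv_boundary
    (fun r hr => (hf r hr).continuousAt.continuousWithinAt)
    (fun r hr => (hf r (Set.Ico_subset_Icc_self hr)).hasDerivWithinAt)
    (by simp [h0]) hB (fun r hr => hb r (Set.Ico_subset_Icc_self hr)) hs

/-- The gradient of a `C²` function with Hessian bounded by `C` is `C`-Lipschitz. -/
lemma norm_gradient_sub_le {E : Type*} [NormedAddCommGroup E] [InnerProductSpace ℝ E]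
    [CompleteSpace E] {V : E → ℝ} {C : ℝ} (hV : ContDiff ℝ 2 V)
    (hHess : ∀ x, ‖fderiv ℝ (gradient V) x‖ ≤ C) (a b : E) :
    ‖gradient V b - gradient V a‖ ≤ C * ‖b - a‖ := by
  have hdiff : Differentiable ℝ (gradient V) :=
    (InnerProductSpace.toDual ℝ E).symm.differentiable.comp
      ((hV.fderiv_right (m := 1) (by norm_num)).differentiable (by norm_num))
  exact convex_univ.norm_image_sub_le_of_norm_fderiv_le (fun x _ => hdiff x)
    (fun x _ => hHess x) (Set.mem_univ a) (Set.mem_univ b)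

/-- The velocity estimate for the flow `x' = y`, `y' = -(G x - z₀)` with `G` Lipschitz. -/
lemma norm_velocity_sub_le {E : Type*} [NormedAddCommGroup E] [NormedSpace ℝ E]
    {G : E → E} {C t : ℝ} (hC : 1 ≤ C) (hG : ∀ a b, ‖G b - G a‖ ≤ C * ‖b - a‖)
    {z₀ : E} {x y : ℝ → E} (ht : 0 ≤ t) (htC : C * t ≤ 1)
    (hx : ∀ s ∈ Set.Icc 0 t, HasDerivAt x (y s) s)
    (hy : ∀ s ∈ Set.Icc 0 t, HasDerivAt y (-(G (x s) - z₀)) s)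
    (hinit : ‖G (x 0) - z₀‖ ≤ ‖y 0‖) :
    ‖y t - y 0‖ ≤ 3 * t * ‖y 0‖ := by
  have hcont : ContinuousOn (fun s => ‖y s - y 0‖) (Set.Icc 0 t) := fun s hs =>
    ((hy s hs).continuousAt.sub continuousAt_const).norm.continuousWithinAt
  obtain ⟨σ, hσ, hmax⟩ := isCompact_Icc.exists_isMaxOn (Set.nonempty_Icc.2 ht) hcont
  set M := ‖y σ - y 0‖ with hM
  have hle : ∀ s ∈ Set.Icc 0 t, ‖y s - y 0‖ ≤ M := fun s hs => hmax hs
  have hpos : ∀ s ∈ Set.Icc 0 t, ‖x s - x 0‖ ≤ (‖y 0‖ + M) * s := by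
    intro s hs
    have h := norm_le_of_norm_deriv_le_affine (f := fun s => x s - x 0) (p := ‖y 0‖ + M) (q := 0)
      (sub_self _) (fun r hr => (hx r hr).sub_const _) (fun r hr => by
        linarith [norm_le_norm_add_norm_sub' (y r) (y 0), hle r hr]) s hs
    simpa using h
  have hvel := norm_le_of_norm_deriv_le_affine (f := fun s => y s - y 0)
    (p := ‖y 0‖) (q := C * (‖y 0‖ + M))
    (sub_self _) (fun r hr => (hy r hr).sub_const _) (fun r hr => by
      rw [norm_neg]
      have h1 := norm_add_le (G (x r) - G (x 0)) (G (x 0) - z₀)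
      rw [sub_add_sub_cancel] at h1
      have h2 := mul_le_mul_of_nonneg_left (hpos r hr) (zero_le_one.trans hC)
      linarith [hG (x 0) (x r)]) σ hσ
  have hM0 : 0 ≤ M := norm_nonneg _
  have hy0 : 0 ≤ ‖y 0‖ := norm_nonneg _
  have ht1 : t ≤ 1 := by nlinarith
  have hσ2 : C * σ ^ 2 ≤ t := by
    have h1 : C * σ ≤ 1 := (mul_le_mul_of_nonneg_left hσ.2 (zero_le_one.trans hC)).trans htC
    nlinarith [hσ.1, hσ.2, mul_le_mul_of_nonneg_right h1 hσ.1]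
  have h3 : M ≤ ‖y 0‖ * t + t / 2 * (‖y 0‖ + M) := by
    have h4 := mul_le_mul_of_nonneg_left hσ.2 hy0
    have h5 := mul_le_mul_of_nonneg_right hσ2 (add_nonneg hy0 hM0)
    have h6 : M ≤ ‖y 0‖ * σ + C * (‖y 0‖ + M) / 2 * σ ^ 2 := hvel
    linarith
  have h7 : t * M ≤ M := mul_le_of_le_one_left hM0 ht1
  linarith [hle t ⟨ht, le_rfl⟩]


/- STATEMENT 14: for the characteristic flow ẋ = y, ẏ = −(∇V(x) − z₀) with
‖Hess V‖ ≤ C_V everywhere and |y₀| ≥ |∇V(x₀) − z₀|, one has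
|x(t) − x₀ − t y₀| ≤ (3/2) t² |y₀| for all t ∈ [0, 1/C_V]. -/
theorem stmt14 (d : ℕ) (hd : 1 ≤ d) (CV : ℝ) (hCV : 1 ≤ CV)
    (V : EuclideanSpace ℝ (Fin d) → ℝ) (hV : ContDiff ℝ 2 V)
    (hHess : ∀ x, ‖fderiv ℝ (gradient V) x‖ ≤ CV)
    (z₀ x₀ y₀ : EuclideanSpace ℝ (Fin d))
    (x y : ℝ → EuclideanSpace ℝ (Fin d))
    (hx0 : x 0 = x₀) (hy0 : y 0 = y₀)
    (hx : ∀ t ∈ Set.Icc (0 : ℝ) (1 / CV), HasDerivAt x (y t) t)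
    (hy : ∀ t ∈ Set.Icc (0 : ℝ) (1 / CV),
      HasDerivAt y (-(gradient V (x t) - z₀)) t)
    (hinit : ‖gradient V x₀ - z₀‖ ≤ ‖y₀‖) :
    ∀ t ∈ Set.Icc (0 : ℝ) (1 / CV),
      ‖x t - x₀ - t • y₀‖ ≤ 3 / 2 * t ^ 2 * ‖y₀‖ := by
  have hC : 0 < CV := zero_lt_one.trans_le hCV
  subst hx0 hy0
  intro t ht
  have h := norm_le_of_norm_deriv_le_affine (f := fun s => x s - x 0 - s • y 0)
    (f' := fun s => y s - y 0) (p := 0) (q := 3 * ‖y 0‖) (T := 1 / CV) (by simp)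
    (fun s hs => by
      have h := ((hx s hs).sub_const (x 0)).sub ((hasDerivAt_id s).smul_const (y 0))
      exact h.congr_deriv (by rw [one_smul]))
    (fun s hs => by
      have hsub : Set.Icc 0 s ⊆ Set.Icc 0 (1 / CV) := Set.Icc_subset_Icc_right hs.2
      have hsC : CV * s ≤ 1 := by
        rw [mul_comm]
        exact (le_div_iff₀ hC).1 hs.2
      linarith [norm_velocity_sub_le hCV (norm_gradient_sub_le hV hHess) hs.1 hsC
        (fun r hr => hx r (hsub hr)) (fun r hr => hy r (hsub hr)) hinit]) t ht
  linarith
end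

section
/- Let d ≥ 1 and C_V ≥ 1. There exist constants c'_V > 0 and θ_V > 0, depending only on C_V, with the following property. Let V : ℝ^d → ℝ be C² with ‖Hess V(x)‖ ≤ C_V for all x, let z₀ ∈ ℝ^d, and let (x(t), y(t)) be a solution on [0, 1] of ẋ = y, ẏ = −(∇V(x) − z₀) with x(0) = x₀, y(0) = y₀. If |y₀| ≤ |∇V(x₀) − z₀|, then there exists an interval I ⊆ [0, 1] of length at least θ_V such that |x(t) − z₀| ≥ c'_V · max{ |y₀|, |x₀ − z₀|, |∇V(x₀) − z₀| } for all t ∈ I. -/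
section SecondOrderFlow

variable {E : Type*} [NormedAddCommGroup E] [NormedSpace ℝ E]

lemma norm_sub_le_of_hasDerivAt_Icc {f f' : ℝ → E} {a b C s t : ℝ}
    (hf : ∀ r ∈ Set.Icc a b, HasDerivAt f (f' r) r) (hC : ∀ r ∈ Set.Icc a b, ‖f' r‖ ≤ C)
    (hs : s ∈ Set.Icc a b) (ht : t ∈ Set.Icc a b) : ‖f t - f s‖ ≤ C * |t - s| :=
  (convex_Icc a b).norm_image_sub_le_of_norm_hasDerivWithin_le
    (fun r hr => (hf r hr).hasDerivWithinAt) hC hs ht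

/-- For `x'' = -F(x)` with `F` Lipschitz and initial speed at most the initial force, the speed
stays at most twice the initial force for a time controlled by the Lipschitz constant. -/
lemma norm_velocity_le_of_force_dominated {F : E → E} {x y : ℝ → E} {C T : ℝ}
    (hF : ∀ a b, ‖F a - F b‖ ≤ C * ‖a - b‖)
    (hC : 1 ≤ C) (hT0 : 0 ≤ T) (hT : C * T ≤ 1 / 2)
    (hx : ∀ t ∈ Set.Icc 0 T, HasDerivAt x (y t) t)
    (hy : ∀ t ∈ Set.Icc 0 T, HasDerivAt y (-F (x t)) t)
    (hy0 : ‖y 0‖ ≤ ‖F (x 0)‖) :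
    ∀ t ∈ Set.Icc 0 T, ‖y t‖ ≤ 2 * ‖F (x 0)‖ := by
  set g := ‖F (x 0)‖
  have hg : 0 ≤ g := norm_nonneg _
  have hT2 : T ≤ 1 / 2 := by nlinarith
  have h0 : (0 : ℝ) ∈ Set.Icc 0 T := ⟨le_rfl, hT0⟩
  have hcont : ContinuousOn (fun t => ‖x t - x 0‖) (Set.Icc 0 T) :=
    ((HasDerivAt.continuousOn hx).sub continuousOn_const).norm
  obtain ⟨m, hm, hmax⟩ := isCompact_Icc.exists_isMaxOn ⟨0, h0⟩ hcont
  set S := ‖x m - x 0‖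
  have hS : 0 ≤ S := norm_nonneg _
  have hxS : ∀ t ∈ Set.Icc 0 T, ‖x t - x 0‖ ≤ S := fun t ht => hmax ht
  have hforce : ∀ t ∈ Set.Icc 0 T, ‖-F (x t)‖ ≤ g + C * S := by
    intro t ht
    rw [norm_neg]
    have h1 := hF (x t) (x 0)
    have h2 := norm_le_norm_add_norm_sub' (F (x t)) (F (x 0))
    have h3 := mul_le_mul_of_nonneg_left (hxS t ht) (by linarith : 0 ≤ C)
    linarith
  have hspeed : ∀ t ∈ Set.Icc 0 T, ‖y t‖ ≤ g + (g + C * S) * T := by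
    intro t ht
    have h1 := norm_sub_le_of_hasDerivAt_Icc hy hforce h0 ht
    rw [sub_zero, abs_of_nonneg ht.1] at h1
    have h2 := norm_le_norm_add_norm_sub' (y t) (y 0)
    have h3 : (g + C * S) * t ≤ (g + C * S) * T :=
      mul_le_mul_of_nonneg_left ht.2 (by positivity)
    linarith
  have hSle : S ≤ (g + (g + C * S) * T) * T := by
    have h1 := norm_sub_le_of_hasDerivAt_Icc hx hspeed h0 hm
    rw [sub_zero, abs_of_nonneg hm.1] at h1
    exact h1.trans (mul_le_mul_of_nonneg_left hm.2 (by positivity))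
  have hCS : C * S ≤ g := by
    have h1 : C * S ≤ (C * T) * (g + (g + C * S) * T) := by nlinarith
    have h2 : (C * T) * (g + (g + C * S) * T) ≤ 1 / 2 * (g + (g + C * S) * (1 / 2)) := by
      gcongr
    linarith
  intro t ht
  have h1 := hspeed t ht
  have h2 : (g + C * S) * T ≤ (g + g) * (1 / 2) := by gcongr
  linarith

/-- Second differences of a solution of `x'' = -F(x)` are bounded below by the initial force. -/
lemma le_norm_second_difference_of_force_dominated {F : E → E} {x y : ℝ → E} {C τ : ℝ}
    (hF : ∀ a b, ‖F a - F b‖ ≤ C * ‖a - b‖)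
    (hC : 1 ≤ C) (hτ0 : 0 ≤ τ) (hτ : C * τ ≤ 1 / 32)
    (hx : ∀ t ∈ Set.Icc 0 τ, HasDerivAt x (y t) t)
    (hy : ∀ t ∈ Set.Icc 0 τ, HasDerivAt y (-F (x t)) t)
    (hy0 : ‖y 0‖ ≤ ‖F (x 0)‖) :
    τ ^ 2 / 8 * ‖F (x 0)‖ ≤ ‖x 0 - (2 : ℝ) • x (τ / 2) + x τ‖ := by
  set g := ‖F (x 0)‖
  have hg : 0 ≤ g := norm_nonneg _
  have h0 : (0 : ℝ) ∈ Set.Icc 0 τ := ⟨le_rfl, hτ0⟩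
  have hspeed := norm_velocity_le_of_force_dominated hF hC hτ0 (by linarith) hx hy hy0
  have hforce : ∀ t ∈ Set.Icc 0 τ, ‖-F (x t) + F (x 0)‖ ≤ 2 * C * g * τ := by
    intro t ht
    have h1 := norm_sub_le_of_hasDerivAt_Icc hx hspeed h0 ht
    rw [sub_zero, abs_of_nonneg ht.1] at h1
    rw [neg_add_eq_sub, norm_sub_rev]
    have h2 : 2 * g * t ≤ 2 * g * τ := mul_le_mul_of_nonneg_left ht.2 (by positivity)
    calc _ ≤ C * ‖x t - x 0‖ := hF _ _
      _ ≤ C * (2 * g * τ) := by gcongr; linarith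
      _ = _ := by ring
  have hvel : ∀ t ∈ Set.Icc 0 τ, ‖y t - y 0 + t • F (x 0)‖ ≤ 2 * C * g * τ * τ := by
    intro t ht
    have hd : ∀ r ∈ Set.Icc 0 τ,
        HasDerivAt (fun r => y r - y 0 + r • F (x 0)) (-F (x r) + F (x 0)) r := by
      intro r hr
      simpa using ((hy r hr).sub_const (y 0)).fun_add ((hasDerivAt_id r).smul_const (F (x 0)))
    have h1 := norm_sub_le_of_hasDerivAt_Icc hd hforce h0 ht
    simp only [sub_self, zero_smul, add_zero, sub_zero, abs_of_nonneg ht.1] at h1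
    exact h1.trans (mul_le_mul_of_nonneg_left ht.2 (by positivity))
  have hpos : ∀ t ∈ Set.Icc 0 τ,
      ‖x t - x 0 - t • y 0 + (t ^ 2 / 2) • F (x 0)‖ ≤ 2 * C * g * τ * τ * t := by
    intro t ht
    have hd : ∀ r ∈ Set.Icc 0 τ,
        HasDerivAt (fun r => x r - x 0 - r • y 0 + (r ^ 2 / 2) • F (x 0))
          (y r - y 0 + r • F (x 0)) r := by
      intro r hr
      have h2 : HasDerivAt (fun r : ℝ => r ^ 2 / 2) r r := by
        simpa using (hasDerivAt_pow 2 r).div_const 2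
      simpa using (((hx r hr).sub_const (x 0)).fun_sub
        ((hasDerivAt_id r).smul_const (y 0))).fun_add
          (h2.smul_const (F (x 0)))
    have h1 := norm_sub_le_of_hasDerivAt_Icc hd hvel h0 ht
    simpa [abs_of_nonneg ht.1] using h1
  have hmid := hpos (τ / 2) ⟨by linarith, by linarith⟩
  have hend := hpos τ ⟨hτ0, le_rfl⟩
  set p := x (τ / 2) - x 0 - (τ / 2) • y 0 + ((τ / 2) ^ 2 / 2) • F (x 0) with hp
  set q := x τ - x 0 - τ • y 0 + (τ ^ 2 / 2) • F (x 0) with hq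
  have hid : (τ ^ 2 / 4) • F (x 0)
      = q - (2 : ℝ) • p - (x 0 - (2 : ℝ) • x (τ / 2) + x τ) := by
    rw [hp, hq]; module
  have hnorm : τ ^ 2 / 4 * g
      ≤ ‖q‖ + 2 * ‖p‖ + ‖x 0 - (2 : ℝ) • x (τ / 2) + x τ‖ := by
    have h1 : ‖(τ ^ 2 / 4) • F (x 0)‖ = τ ^ 2 / 4 * g := by
      rw [norm_smul, Real.norm_of_nonneg (by positivity)]
    rw [← h1, hid]
    have h2 : ‖(2 : ℝ) • p‖ = 2 * ‖p‖ := by rw [norm_smul, Real.norm_ofNat]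
    rw [← h2]
    exact (norm_sub_le _ _).trans (by gcongr; exact norm_sub_le _ _)
  have herr : (C * τ) * (g * τ ^ 2) ≤ 1 / 32 * (g * τ ^ 2) := by gcongr
  linarith

/-- A solution of `x'' = -F(x)` with dominating initial force spends a positive time away from
any given point. -/
lemma exists_Icc_le_norm_sub_of_force_dominated {F : E → E} {x y : ℝ → E} {C τ : ℝ}
    (hF : ∀ a b, ‖F a - F b‖ ≤ C * ‖a - b‖)
    (hC : 1 ≤ C) (hτ0 : 0 ≤ τ) (hτ : C * τ ≤ 1 / 32)
    (hx : ∀ t ∈ Set.Icc (0 : ℝ) 1, HasDerivAt x (y t) t)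
    (hy : ∀ t ∈ Set.Icc (0 : ℝ) 1, HasDerivAt y (-F (x t)) t)
    (hy0 : ‖y 0‖ ≤ ‖F (x 0)‖) (z : E) :
    ∃ a b : ℝ, 0 ≤ a ∧ b ≤ 1 ∧ τ ^ 2 / 128 ≤ b - a ∧ ∀ t ∈ Set.Icc a b,
      τ ^ 2 / 512 * max (max ‖y 0‖ ‖x 0 - z‖) ‖F (x 0)‖ ≤ ‖x t - z‖ := by
  set g := ‖F (x 0)‖
  have hg : 0 ≤ g := norm_nonneg _
  have hτ1 : τ ≤ 1 / 32 := by nlinarith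
  have hsq : τ ^ 2 ≤ τ := by nlinarith
  have hsub : ∀ {T : ℝ}, T ≤ 1 → Set.Icc 0 T ⊆ Set.Icc (0 : ℝ) 1 :=
    fun hT => Set.Icc_subset_Icc_right hT
  have hspeed := norm_velocity_le_of_force_dominated (T := 2 * τ) hF hC (by linarith)
    (by linarith) (fun t ht => hx t (hsub (by linarith) ht))
    (fun t ht => hy t (hsub (by linarith) ht)) hy0
  have hlip : ∀ s ∈ Set.Icc 0 τ, ∀ t ∈ Set.Icc s (s + τ ^ 2 / 128),
      ‖x s - z‖ - τ ^ 2 / 64 * g ≤ ‖x t - z‖ := by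
    intro s hs t ht
    have h1 := norm_sub_le_of_hasDerivAt_Icc
      (fun r hr => hx r (hsub (by linarith) hr)) hspeed
      (s := s) (t := t) ⟨hs.1, by linarith [hs.2]⟩
      ⟨hs.1.trans ht.1, by linarith [hs.2, ht.2]⟩
    rw [abs_of_nonneg (sub_nonneg.2 ht.1)] at h1
    have h2 : 2 * g * (t - s) ≤ 2 * g * (τ ^ 2 / 128) := by
      gcongr; linarith [ht.2]
    have h3 := norm_sub_norm_le (x s - z) (x t - z)
    rw [sub_sub_sub_cancel_right, norm_sub_rev (x s) (x t)] at h3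
    linarith
  suffices h : ∃ s ∈ Set.Icc 0 τ,
      τ ^ 2 / 512 * max (max ‖y 0‖ ‖x 0 - z‖) g ≤ ‖x s - z‖ - τ ^ 2 / 64 * g by
    obtain ⟨s, hs, h⟩ := h
    exact ⟨s, s + τ ^ 2 / 128, hs.1, by linarith [hs.2], by linarith,
      fun t ht => h.trans (hlip s hs t ht)⟩
  rcases le_total (6 * g) ‖x 0 - z‖ with hfar | hnear
  · refine ⟨0, ⟨le_rfl, hτ0⟩, ?_⟩
    have hmax : max (max ‖y 0‖ ‖x 0 - z‖) g ≤ ‖x 0 - z‖ :=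
      max_le (max_le (by linarith) le_rfl) (by linarith)
    have h1 : τ ^ 2 / 512 * max (max ‖y 0‖ ‖x 0 - z‖) g ≤ 1 / 512 * ‖x 0 - z‖ := by
      gcongr; linarith
    have h2 : τ ^ 2 / 64 * g ≤ 1 / 64 * g := by gcongr; linarith
    linarith
  · have hmax : max (max ‖y 0‖ ‖x 0 - z‖) g ≤ 6 * g :=
      max_le (max_le (by linarith) hnear) (by linarith)
    have h1 : τ ^ 2 / 512 * max (max ‖y 0‖ ‖x 0 - z‖) g ≤ τ ^ 2 / 512 * (6 * g) := by
      gcongr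
    have hτg : 0 ≤ τ ^ 2 * g := by positivity
    have hdiff := le_norm_second_difference_of_force_dominated hF hC hτ0 hτ
      (fun t ht => hx t (hsub (by linarith) ht))
      (fun t ht => hy t (hsub (by linarith) ht)) hy0
    have htri : ‖x 0 - (2 : ℝ) • x (τ / 2) + x τ‖
        ≤ ‖x 0 - z‖ + 2 * ‖x (τ / 2) - z‖ + ‖x τ - z‖ := by
      have h2 : ‖(2 : ℝ) • (x (τ / 2) - z)‖ = 2 * ‖x (τ / 2) - z‖ := by
        rw [norm_smul, Real.norm_ofNat]
      rw [← h2, show x 0 - (2 : ℝ) • x (τ / 2) + x τ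
        = (x 0 - z) - (2 : ℝ) • (x (τ / 2) - z) + (x τ - z) by module]
      exact (norm_add_le _ _).trans (by gcongr; exact norm_sub_le _ _)
    by_contra! hcon
    have ha := hcon 0 ⟨le_rfl, hτ0⟩
    have hb := hcon (τ / 2) ⟨by linarith, by linarith⟩
    have hc := hcon τ ⟨hτ0, le_rfl⟩
    linarith

end SecondOrderFlow

lemma norm_gradient_sub_le_of_norm_fderiv_gradient_le {H : Type*} [NormedAddCommGroup H]
    [InnerProductSpace ℝ H] [CompleteSpace H] {V : H → ℝ} {C : ℝ} (hV : ContDiff ℝ 2 V)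
    (hC : ∀ x, ‖fderiv ℝ (gradient V) x‖ ≤ C) (a b : H) :
    ‖gradient V a - gradient V b‖ ≤ C * ‖a - b‖ := by
  have hdiff : Differentiable ℝ (gradient V) :=
    (InnerProductSpace.toDual ℝ H).symm.differentiable.comp
      ((hV.fderiv_right (m := 1) (by norm_num)).differentiable (by norm_num))
  exact convex_univ.norm_image_sub_le_of_norm_fderiv_le (fun x _ => hdiff x)
    (fun x _ => hC x) (Set.mem_univ b) (Set.mem_univ a)


/- STATEMENT 18 (force-dominated case): there exist c'_V, θ_V > 0 depending only on
C_V such that for any V with ‖Hess V‖ ≤ C_V, any z₀, and any solution of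
ẋ = y, ẏ = −(∇V(x) − z₀) on [0,1] with |y₀| ≤ |∇V(x₀) − z₀|, there is a subinterval of
[0,1] of length ≥ θ_V on which
|x(t) − z₀| ≥ c'_V · max{|y₀|, |x₀ − z₀|, |∇V(x₀) − z₀|}. -/
theorem stmt18 (d : ℕ) (hd : 1 ≤ d) (CV : ℝ) (hCV : 1 ≤ CV) :
    ∃ cV' > (0 : ℝ), ∃ θV > (0 : ℝ),
      ∀ (V : EuclideanSpace ℝ (Fin d) → ℝ), ContDiff ℝ 2 V →
        (∀ x, ‖fderiv ℝ (gradient V) x‖ ≤ CV) →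
        ∀ (z₀ x₀ y₀ : EuclideanSpace ℝ (Fin d))
          (x y : ℝ → EuclideanSpace ℝ (Fin d)),
          x 0 = x₀ → y 0 = y₀ →
          (∀ t ∈ Set.Icc (0 : ℝ) 1, HasDerivAt x (y t) t) →
          (∀ t ∈ Set.Icc (0 : ℝ) 1, HasDerivAt y (-(gradient V (x t) - z₀)) t) →
          ‖y₀‖ ≤ ‖gradient V x₀ - z₀‖ →
          ∃ a b : ℝ, 0 ≤ a ∧ b ≤ 1 ∧ θV ≤ b - a ∧
            ∀ t ∈ Set.Icc a b,
              cV' * max (max ‖y₀‖ ‖x₀ - z₀‖) ‖gradient V x₀ - z₀‖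
                ≤ ‖x t - z₀‖ := by
  refine ⟨(1 / (32 * CV)) ^ 2 / 512, by positivity, (1 / (32 * CV)) ^ 2 / 128, by positivity, ?_⟩
  rintro V hV hHess z₀ _ _ x y rfl rfl hx hy hy0
  refine exists_Icc_le_norm_sub_of_force_dominated (F := fun q => gradient V q - z₀)
    (fun a b => ?_) hCV (by positivity) (le_of_eq (by field_simp)) hx hy hy0 z₀
  rw [sub_sub_sub_cancel_right]
  exact norm_gradient_sub_le_of_norm_fderiv_gradient_le hV hHess a b
end

section
/- Let m ≥ 1, γ > 0, and let V : ℝᵐ → ℝ be C² with uniformly bounded Hessian, such that the critical set of W(x) := V(x) − |x|²/2 is finite, say {x₁, …, x_N}, and such that there is C₀ > 0 with |∇V(x) − x| ≥ 1/C₀ whenever |x| ≥ C₀. Then for every ε > 0 there exists C > 0 with the following property: for every (x₀, y₀, z₀) ∈ ℝ^{3m} satisfying |(x₀, y₀, z₀) − (x_j, 0, x_j)| ≥ ε for all j = 1, …, N, and every solution (x(t), y(t)) on [0, 1] of the system ẋ = y, ẏ = −(∇V(x) − z₀) with x(0) = x₀, y(0) = y₀, the Lebesgue measure of the set { t ∈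 [0, 1] : (γ/2) |x(t) − z₀|² ≥ 1/C } is at least 1/C. -/
open MeasureTheory in
/-- A continuous function whose norm is at least `δ` only on a set of measure less than `η`
has integral norm at most `δ + M * η`, where `M` bounds its norm. -/
lemma setIntegral_norm_le_of_volume_lt {E : Type*} [NormedAddCommGroup E]
    {u : ℝ → E} (hu : ContinuousOn u (Set.Icc 0 1)) {δ η M : ℝ} (hη : 0 < η)
    (hM : ∀ t ∈ Set.Icc (0 : ℝ) 1, ‖u t‖ ≤ M) (hδ : 0 ≤ δ)
    (hvol : volume {t ∈ Set.Icc (0 : ℝ) 1 | δ ≤ ‖u t‖} < ENNReal.ofReal η) :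
    ∫ t in Set.Icc (0 : ℝ) 1, ‖u t‖ ≤ δ + M * η := by
  set B := {t ∈ Set.Icc (0 : ℝ) 1 | δ ≤ ‖u t‖} with hB
  have hM0 : 0 ≤ M := (norm_nonneg _).trans (hM 0 (by simp))
  have hBc : IsClosed B := hu.norm.preimage_isClosed_of_isClosed isClosed_Icc isClosed_Ici
  have hBs : B ⊆ Set.Icc 0 1 := fun t ht => ht.1
  have hBfin : volume B ≠ ⊤ := hvol.ne_top
  have hint : IntegrableOn (fun t => B.indicator (fun _ => M) t) (Set.Icc (0 : ℝ) 1) :=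
    ((integrable_indicator_iff hBc.measurableSet).2
      (integrableOn_const hBfin)).integrableOn
  have hconst : IntegrableOn (fun _ : ℝ => δ) (Set.Icc (0 : ℝ) 1) :=
    integrableOn_const (by simp)
  calc ∫ t in Set.Icc (0 : ℝ) 1, ‖u t‖
      ≤ ∫ t in Set.Icc (0 : ℝ) 1, (δ + B.indicator (fun _ => M) t) := by
        refine setIntegral_mono_on (hu.norm.integrableOn_compact isCompact_Icc)
          (hconst.add hint) measurableSet_Icc fun t ht => ?_
        by_cases htB : t ∈ B
        · simpa [htB] using (hM t ht).trans (le_add_of_nonneg_left hδ)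
        · have : ‖u t‖ < δ := by
            by_contra! h
            exact htB ⟨ht, h⟩
          simpa [htB] using this.le
    _ = δ + volume.real B * M := by
        rw [integral_add hconst hint, setIntegral_indicator hBc.measurableSet,
          Set.inter_eq_self_of_subset_right hBs]
        simp
    _ ≤ δ + M * η := by
        have : volume.real B ≤ η := ENNReal.toReal_le_of_le_ofReal hη.le hvol.le
        nlinarith

/-- The coefficients of a vector-valued quadratic polynomial on `[0, 1]` are controlled by its
values at three well-separated points. -/
lemma norm_coeff_quadratic_le {E : Type*} [NormedAddCommGroup E] [NormedSpace ℝ E]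
    (a b q : E) {d t₁ t₂ t₃ : ℝ} (h₁ : t₁ ∈ Set.Icc (0 : ℝ) (1 / 5))
    (h₂ : t₂ ∈ Set.Icc (2 / 5 : ℝ) (3 / 5)) (h₃ : t₃ ∈ Set.Icc (4 / 5 : ℝ) 1)
    (hp₁ : ‖a + t₁ • b + t₁ ^ 2 • q‖ ≤ d) (hp₂ : ‖a + t₂ • b + t₂ ^ 2 • q‖ ≤ d)
    (hp₃ : ‖a + t₃ • b + t₃ ^ 2 • q‖ ≤ d) :
    ‖a‖ + ‖b‖ + 2 * ‖q‖ ≤ 150 * d := by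
  obtain ⟨h₁, h₁'⟩ := h₁
  obtain ⟨h₂, h₂'⟩ := h₂
  obtain ⟨h₃, h₃'⟩ := h₃
  have slope : ∀ s t : ℝ, s + 1 / 5 ≤ t → ‖a + s • b + s ^ 2 • q‖ ≤ d →
      ‖a + t • b + t ^ 2 • q‖ ≤ d → ‖b + (s + t) • q‖ ≤ 10 * d := by
    intro s t hst hs ht
    have key : (t - s) • (b + (s + t) • q) =
        (a + t • b + t ^ 2 • q) - (a + s • b + s ^ 2 • q) := by module
    have h := norm_sub_le (a + t • b + t ^ 2 • q) (a + s • b + s ^ 2 • q)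
    rw [← key, norm_smul, Real.norm_of_nonneg (by linarith)] at h
    nlinarith [norm_nonneg (b + (s + t) • q)]
  have s₁ := slope t₁ t₂ (by linarith) hp₁ hp₂
  have s₂ := slope t₂ t₃ (by linarith) hp₂ hp₃
  have hq : ‖q‖ ≤ 34 * d := by
    have key : (t₃ - t₁) • q = (b + (t₂ + t₃) • q) - (b + (t₁ + t₂) • q) := by module
    have h := norm_sub_le (b + (t₂ + t₃) • q) (b + (t₁ + t₂) • q)
    rw [← key, norm_smul, Real.norm_of_nonneg (by linarith)] at h
    nlinarith [norm_nonneg q]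
  have hb : ‖b‖ ≤ 44 * d := by
    have h := norm_sub_le (b + (t₁ + t₂) • q) ((t₁ + t₂) • q)
    rw [add_sub_cancel_right, norm_smul, Real.norm_of_nonneg (by linarith)] at h
    nlinarith [norm_nonneg q]
  have ha : ‖a‖ ≤ 12 * d := by
    have h := norm_sub_le (a + t₁ • b + t₁ ^ 2 • q) (t₁ • b + t₁ ^ 2 • q)
    rw [add_assoc, add_sub_cancel_right, ← add_assoc] at h
    have h' := norm_add_le (t₁ • b) (t₁ ^ 2 • q)
    rw [norm_smul, norm_smul, Real.norm_of_nonneg h₁, Real.norm_of_nonneg (sq_nonneg _)] at h'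
    have : t₁ ^ 2 ≤ 1 / 25 := by nlinarith
    nlinarith [norm_nonneg q, norm_nonneg b]
  have : 0 ≤ d := (norm_nonneg _).trans hp₁
  linarith

open MeasureTheory in
/-- If a solution of `u'' = -(g + h)` with `‖h‖ ≤ L ‖u‖` is smaller than `δ` off a set of
sufficiently small measure, then its initial data and `g` are of size `O(δ)`. -/
lemma norm_data_le_of_volume_lt {E : Type*} [NormedAddCommGroup E] [NormedSpace ℝ E]
    [CompleteSpace E] {u y h : ℝ → E} {g : E} {L δ η : ℝ} (hL : 0 ≤ L) (hδ : 0 < δ)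
    (hη : 0 < η) (hη' : η ≤ 1 / 10) (hLη : 1200 * (L * η) ≤ 1)
    (hu : ∀ t ∈ Set.Icc (0 : ℝ) 1, HasDerivAt u (y t) t)
    (hy : ∀ t ∈ Set.Icc (0 : ℝ) 1, HasDerivAt y (-(g + h t)) t)
    (hh : ContinuousOn h (Set.Icc 0 1))
    (hhu : ∀ t ∈ Set.Icc (0 : ℝ) 1, ‖h t‖ ≤ L * ‖u t‖)
    (hvol : volume {t ∈ Set.Icc (0 : ℝ) 1 | δ ≤ ‖u t‖} < ENNReal.ofReal η) :
    ‖u 0‖ + ‖y 0‖ + ‖g‖ ≤ 400 * (1 + L) * δ := by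
  have huc : ContinuousOn u (Set.Icc 0 1) := fun t ht => (hu t ht).continuousAt.continuousWithinAt
  obtain ⟨τ, hτ, hmax⟩ := isCompact_Icc.exists_isMaxOn (Set.nonempty_Icc.2 zero_le_one) huc.norm
  set M := ‖u τ‖
  have hM : ∀ t ∈ Set.Icc (0 : ℝ) 1, ‖u t‖ ≤ M := fun t ht => hmax ht
  have hint := setIntegral_norm_le_of_volume_lt huc hη hM hδ.le hvol
  set e := L * (δ + M * η) with he
  have hM0 : 0 ≤ M := norm_nonneg _
  have hvel : ∀ t ∈ Set.Icc (0 : ℝ) 1, ‖y t - y 0 + t • g‖ ≤ e := by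
    intro t ht
    have hsub : Set.Icc 0 t ⊆ Set.Icc (0 : ℝ) 1 := Set.Icc_subset_Icc_right ht.2
    have hftc : ∫ s in (0 : ℝ)..t, -h s = y t - y 0 + t • g := by
      rw [intervalIntegral.integral_eq_sub_of_hasDerivAt (f := fun s => y s + s • g)]
      · simp; abel
      · intro s hs
        rw [Set.uIcc_of_le ht.1] at hs
        exact ((hy s (hsub hs)).add ((hasDerivAt_id s).smul_const g)).congr_deriv (by module)
      · apply ContinuousOn.intervalIntegrable
        rw [Set.uIcc_of_le ht.1]
        exact (hh.mono hsub).neg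
    rw [← hftc]
    calc ‖∫ s in (0 : ℝ)..t, -h s‖
        ≤ ∫ s in (0 : ℝ)..t, ‖-h s‖ := intervalIntegral.norm_integral_le_integral_norm ht.1
      _ = ∫ s in Set.Icc 0 t, ‖h s‖ := by
          rw [intervalIntegral.integral_of_le ht.1, integral_Icc_eq_integral_Ioc]
          simp
      _ ≤ ∫ s in Set.Icc (0 : ℝ) 1, ‖h s‖ :=
          setIntegral_mono_set (hh.norm.integrableOn_compact isCompact_Icc)
            (Filter.Eventually.of_forall fun _ => norm_nonneg _) hsub.eventuallyLE
      _ ≤ ∫ s in Set.Icc (0 : ℝ) 1, L * ‖u s‖ :=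
          setIntegral_mono_on (hh.norm.integrableOn_compact isCompact_Icc)
            ((huc.norm.integrableOn_compact isCompact_Icc).const_mul L) measurableSet_Icc hhu
      _ ≤ e := by
          rw [integral_const_mul]
          exact mul_le_mul_of_nonneg_left hint hL
  have he0 : 0 ≤ e := (norm_nonneg _).trans (hvel 0 (by simp))
  have hpos : ∀ t ∈ Set.Icc (0 : ℝ) 1,
      ‖u t - (u 0 + t • y 0 + t ^ 2 • (-(1 / 2 : ℝ) • g))‖ ≤ e := by
    intro t ht
    have := norm_image_sub_le_of_norm_deriv_le_segment_01' (C := e)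
      (f := fun s => u (t * s) - (u 0 + (t * s) • y 0 + (t * s) ^ 2 • (-(1 / 2 : ℝ) • g)))
      (f' := fun s => t • (y (t * s) - y 0 + (t * s) • g)) ?_ ?_
    · simpa using this
    · intro s hs
      have hts : t * s ∈ Set.Icc (0 : ℝ) 1 :=
        ⟨mul_nonneg ht.1 hs.1, mul_le_one₀ ht.2 hs.1 hs.2⟩
      have hlin : HasDerivAt (fun s : ℝ => t * s) t s := by
        simpa using (hasDerivAt_id s).const_mul t
      have h1 := (hu _ hts).scomp s hlin
      have h2 := (hlin.smul_const (y 0)).const_add (u 0)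
      have h3 := (hlin.pow 2).smul_const (-(1 / 2 : ℝ) • g)
      refine ((h1.sub (h2.add h3)).congr_deriv ?_).hasDerivWithinAt
      simp only [Nat.cast_ofNat, Nat.add_one_sub_one, pow_one]
      module
    · intro s hs
      have hts : t * s ∈ Set.Icc (0 : ℝ) 1 :=
        ⟨mul_nonneg ht.1 hs.1, mul_le_one₀ ht.2 hs.1 hs.2.le⟩
      rw [norm_smul, Real.norm_of_nonneg ht.1]
      nlinarith [hvel _ hts, ht.1, ht.2]
  have hgood : ∀ a : ℝ, 0 ≤ a → a + 1 / 5 ≤ 1 → ∃ t ∈ Set.Icc a (a + 1 / 5), ‖u t‖ < δ := by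
    intro a ha ha'
    by_contra! hcon
    have hle : volume (Set.Icc a (a + 1 / 5)) ≤
        volume {t ∈ Set.Icc (0 : ℝ) 1 | δ ≤ ‖u t‖} :=
      measure_mono fun t ht => ⟨⟨ha.trans ht.1, ht.2.trans ha'⟩, hcon t ht⟩
    rw [Real.volume_Icc] at hle
    have := (ENNReal.ofReal_lt_ofReal_iff hη).1 (hle.trans_lt hvol)
    linarith
  have hsmall : ∀ t ∈ Set.Icc (0 : ℝ) 1, ‖u t‖ < δ →
      ‖u 0 + t • y 0 + t ^ 2 • (-(1 / 2 : ℝ) • g)‖ ≤ δ + e := by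
    intro t ht hut
    have := norm_sub_norm_le (u 0 + t • y 0 + t ^ 2 • (-(1 / 2 : ℝ) • g)) (u t)
    rw [norm_sub_rev] at this
    linarith [hpos t ht]
  obtain ⟨t₁, h₁, hu₁⟩ := hgood 0 le_rfl (by norm_num)
  obtain ⟨t₂, h₂, hu₂⟩ := hgood (2 / 5) (by norm_num) (by norm_num)
  obtain ⟨t₃, h₃, hu₃⟩ := hgood (4 / 5) (by norm_num) (by norm_num)
  norm_num at h₁ h₂ h₃
  have hcoeff := norm_coeff_quadratic_le (u 0) (y 0) (-(1 / 2 : ℝ) • g)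
    (t₁ := t₁) (t₂ := t₂) (t₃ := t₃) h₁ h₂ h₃
    (hsmall t₁ ⟨by linarith [h₁.1], by linarith [h₁.2]⟩ hu₁)
    (hsmall t₂ ⟨by linarith [h₂.1], by linarith [h₂.2]⟩ hu₂)
    (hsmall t₃ ⟨by linarith [h₃.1], by linarith [h₃.2]⟩ hu₃)
  have hg2 : ‖-(1 / 2 : ℝ) • g‖ = 1 / 2 * ‖g‖ := by rw [norm_smul]; norm_num
  rw [hg2] at hcoeff
  have hMle : M ≤ ‖u 0‖ + ‖y 0‖ + ‖g‖ + e := by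
    have h0 := norm_sub_norm_le (u τ) (u 0 + τ • y 0 + τ ^ 2 • (-(1 / 2 : ℝ) • g))
    have h1 := norm_add₃_le (a := u 0) (b := τ • y 0) (c := τ ^ 2 • (-(1 / 2 : ℝ) • g))
    rw [norm_smul τ, norm_smul (τ ^ 2), hg2, Real.norm_of_nonneg hτ.1,
      Real.norm_of_nonneg (sq_nonneg τ)] at h1
    have h2 : τ ^ 2 ≤ 1 := pow_le_one₀ hτ.1 hτ.2
    have h3 := hpos τ hτ
    nlinarith [norm_nonneg (y 0), norm_nonneg g, hτ.2]
  have hLM : 1200 * (L * η * M) ≤ M := by nlinarith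
  have he' : e = L * δ + L * η * M := by rw [he]; ring
  have hLδ : 0 ≤ L * δ := by positivity
  nlinarith

/-- The gradient of `V - ‖·‖² / 2`. -/
lemma gradient_sub_half_norm_sq {E : Type*} [NormedAddCommGroup E] [InnerProductSpace ℝ E]
    [CompleteSpace E] {V : E → ℝ} {x : E} (hV : DifferentiableAt ℝ V x) :
    gradient (fun v => V v - ‖v‖ ^ 2 / 2) x = gradient V x - x := by
  apply HasGradientAt.gradient
  rw [hasGradientAt_iff_hasFDerivAt, map_sub]
  refine hV.hasGradientAt.hasFDerivAt.sub ?_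
  have h : HasFDerivAt (fun v : E => ‖v‖ ^ 2 / 2) ((2 : ℝ)⁻¹ • 2 • innerSL ℝ x) x := by
    simpa only [div_eq_inv_mul] using
      (hasStrictFDerivAt_norm_sq x).hasFDerivAt.const_mul (2 : ℝ)⁻¹
  exact h.congr_fderiv (by ext v; simp)

/-- The gradient of a `C²` function is `C¹`. -/
lemma ContDiff.gradient_one {E : Type*} [NormedAddCommGroup E] [InnerProductSpace ℝ E]
    [CompleteSpace E] {V : E → ℝ} (hV : ContDiff ℝ 2 V) : ContDiff ℝ 1 (gradient V) :=
  (InnerProductSpace.toDual ℝ E).symm.contDiff.comp (hV.fderiv_right (m := 1) (by norm_num))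

/-- A continuous map that is bounded away from zero near infinity is bounded away from zero
off any neighbourhood of its zeros. -/
lemma exists_pos_le_norm_of_far_from_zeros {E F ι : Type*} [NormedAddCommGroup E] [ProperSpace E]
    [NormedAddCommGroup F] {G : E → F} (hG : Continuous G) {crit : ι → E}
    (hcrit : ∀ x, G x = 0 → ∃ j, x = crit j) {C₀ : ℝ} (hC₀ : 0 < C₀)
    (hgrad : ∀ x, C₀ ≤ ‖x‖ → 1 / C₀ ≤ ‖G x‖) {r : ℝ} (hr : 0 < r) :
    ∃ c > 0, ∀ z, (∀ j, r ≤ ‖z - crit j‖) → c ≤ ‖G z‖ := by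
  set K := Metric.closedBall (0 : E) C₀ ∩ ⋂ j, {z | r ≤ ‖z - crit j‖}
  have hK : IsCompact K := (isCompact_closedBall _ _).inter_right
    (isClosed_iInter fun j => isClosed_le continuous_const (by fun_prop))
  have hpos : ∃ c > 0, ∀ z ∈ K, c ≤ ‖G z‖ := by
    rcases K.eq_empty_or_nonempty with hE | hne
    · exact ⟨1, one_pos, by simp [hE]⟩
    · obtain ⟨w, hw, hmin⟩ := hK.exists_isMinOn hne hG.norm.continuousOn
      refine ⟨‖G w‖, norm_pos_iff.2 fun h0 => ?_, fun z hz => hmin hz⟩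
      obtain ⟨j, hj⟩ := hcrit w h0
      have := Set.mem_iInter.1 hw.2 j
      simp only [hj, Set.mem_ofPred_eq, sub_self, norm_zero] at this
      linarith
  obtain ⟨c, hc, hcK⟩ := hpos
  refine ⟨min c (1 / C₀), lt_min hc (by positivity), fun z hz => ?_⟩
  rcases le_total ‖z‖ C₀ with h | h
  · exact (min_le_left _ _).trans
      (hcK z ⟨by simpa using h, Set.mem_iInter.2 hz⟩)
  · exact (min_le_right _ _).trans (hgrad z h)

/- STATEMENT 19 (dynamical condition): if V is C² with uniformly bounded Hessian, the
critical set of W(x) = V(x) − |x|²/2 is finite, {x₁,…,x_N}, and |∇V(x) − x| ≥ 1/C₀ for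
|x| ≥ C₀, then for every ε > 0 there is C > 0 such that along every trajectory of
ẋ = y, ẏ = −(∇V(x) − z₀) on [0,1] starting at (x₀,y₀,z₀) with
|(x₀,y₀,z₀) − (x_j,0,x_j)| ≥ ε for all j, the set of times t ∈ [0,1] with
(γ/2)|x(t) − z₀|² ≥ 1/C has Lebesgue measure at least 1/C. -/
theorem stmt19 (m N : ℕ) (hm : 1 ≤ m) (γ : ℝ) (hγ : 0 < γ)
    (V : EuclideanSpace ℝ (Fin m) → ℝ) (hV : ContDiff ℝ 2 V)
    (hHess : ∃ CV : ℝ, ∀ x, ‖fderiv ℝ (gradient V) x‖ ≤ CV)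
    (crit : Fin N → EuclideanSpace ℝ (Fin m))
    (hcrit : ∀ x, gradient (fun v => V v - ‖v‖ ^ 2 / 2) x = 0 ↔ ∃ j, x = crit j)
    (C₀ : ℝ) (hC₀ : 0 < C₀)
    (hgrad : ∀ x, C₀ ≤ ‖x‖ → 1 / C₀ ≤ ‖gradient V x - x‖) :
    ∀ ε > 0, ∃ C > (0 : ℝ),
      ∀ x₀ y₀ z₀ : EuclideanSpace ℝ (Fin m),
        (∀ j, ε ≤ Real.sqrt (‖x₀ - crit j‖ ^ 2 + ‖y₀‖ ^ 2 + ‖z₀ - crit j‖ ^ 2)) →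
        ∀ x y : ℝ → EuclideanSpace ℝ (Fin m),
          x 0 = x₀ → y 0 = y₀ →
          (∀ t ∈ Set.Icc (0 : ℝ) 1, HasDerivAt x (y t) t) →
          (∀ t ∈ Set.Icc (0 : ℝ) 1, HasDerivAt y (-(gradient V (x t) - z₀)) t) →
          ENNReal.ofReal (1 / C) ≤
            MeasureTheory.volume
              {t ∈ Set.Icc (0 : ℝ) 1 | 1 / C ≤ γ / 2 * ‖x t - z₀‖ ^ 2} := by
  obtain ⟨CV, hCV⟩ := hHess
  intro ε hε
  have hgr := hV.gradient_one
  have hgc : Continuous (gradient V) := hgr.continuous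
  have hdiff : Differentiable ℝ V := hV.differentiable (by norm_num)
  set L := |CV| with hLdef
  have hL : 0 ≤ L := abs_nonneg _
  have hLip : ∀ a b, ‖gradient V b - gradient V a‖ ≤ L * ‖b - a‖ := fun a b =>
    convex_univ.norm_image_sub_le_of_norm_fderiv_le
      (fun x _ => hgr.differentiable (by norm_num) x)
      (fun x _ => (hCV x).trans (le_abs_self _)) (Set.mem_univ a) (Set.mem_univ b)
  obtain ⟨c₁, hc₁, hfar⟩ := exists_pos_le_norm_of_far_from_zeros (G := fun x => gradient V x - x)
    (hgc.sub continuous_id)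
    (fun x hx => (hcrit x).1 (by rw [gradient_sub_half_norm_sq (hdiff x)]; exact hx))
    hC₀ hgrad (r := ε / 4) (by positivity)
  set c := min c₁ (ε / 4) with hc
  have hc0 : 0 < c := lt_min hc₁ (by positivity)
  set δ := c / (800 * (1 + L)) with hδ
  have hδ0 : 0 < δ := by positivity
  set η := 1 / (1200 * (1 + L)) with hη
  have hη0 : 0 < η := by positivity
  set κ := min η (γ / 2 * δ ^ 2) with hκ
  have hκ0 : 0 < κ := lt_min hη0 (by positivity)
  refine ⟨1 / κ, by positivity, ?_⟩
  rintro x₀ y₀ z₀ hdist x y rfl rfl hx hy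
  rw [one_div_one_div]
  by_contra! hlt
  have hxc : ContinuousOn x (Set.Icc 0 1) := fun t ht => (hx t ht).continuousAt.continuousWithinAt
  have hηmul : 1200 * (1 + L) * η = 1 := by rw [hη]; field_simp
  have hbound := norm_data_le_of_volume_lt (u := fun t => x t - z₀) (y := y)
    (h := fun t => gradient V (x t) - gradient V z₀) (g := gradient V z₀ - z₀)
    (L := L) (δ := δ) (η := η) hL hδ0 hη0
    (by nlinarith) (by nlinarith)
    (fun t ht => (hx t ht).sub_const z₀)
    (fun t ht => (hy t ht).congr_deriv (by abel))
    ((hgc.comp_continuousOn hxc).sub continuousOn_const)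
    (fun t _ => hLip z₀ (x t))
    (by
      refine lt_of_le_of_lt (MeasureTheory.measure_mono ?_)
        (hlt.trans_le (ENNReal.ofReal_le_ofReal (min_le_left _ _)))
      rintro t ⟨ht, hδt⟩
      refine ⟨ht, ?_⟩
      refine (min_le_right _ _).trans ?_
      gcongr)
  have hval : 400 * (1 + L) * δ = c / 2 := by rw [hδ]; field_simp; norm_num
  rw [hval] at hbound
  have hx0 := norm_nonneg (x 0 - z₀)
  have hy0 := norm_nonneg (y 0)
  have hg0 := norm_nonneg (gradient V z₀ - z₀)
  have hcc₁ : c ≤ c₁ := min_le_left _ _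
  have hcε : c ≤ ε / 4 := min_le_right _ _
  have hnear : ∃ j, ‖z₀ - crit j‖ < ε / 4 := by
    by_contra! hcon
    have := hfar z₀ hcon
    linarith
  obtain ⟨j, hj⟩ := hnear
  have htri : ‖x 0 - crit j‖ ≤ ‖x 0 - z₀‖ + ‖z₀ - crit j‖ := norm_sub_le_norm_sub_add_norm_sub _ _ _
  have hsq := (Real.le_sqrt' hε).1 (hdist j)
  have b1 : ‖x 0 - crit j‖ ^ 2 ≤ (ε / 2) ^ 2 :=
    pow_le_pow_left₀ (norm_nonneg _) (by linarith) 2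
  have b2 : ‖y 0‖ ^ 2 ≤ (ε / 4) ^ 2 := pow_le_pow_left₀ hy0 (by linarith) 2
  have b3 : ‖z₀ - crit j‖ ^ 2 ≤ (ε / 4) ^ 2 := pow_le_pow_left₀ (norm_nonneg _) hj.le 2
  nlinarith [sq_pos_of_pos hε]
end
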